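/- Let E ∈ C³(ℝ^N), L > 0, and let Ω ⊂ ℝ^N be a bounded (hence compact) closed connected component of the sublevel set { x ∈ ℝ^N : ‖∇E(x)‖ ≤ L }. Suppose λ1(x) < 0 < λ2(x) for all x ∈ Ω. Then for every x0 ∈ Ω the ISD with initial condition x(0) = x0 admits a unique global solution x ∈ C¹([0,∞); Ω), and there exist an index-1 saddle x* ∈ Ω and constants K, c > 0 such that ‖x(t) − x*‖ ≤ K e^{−ct} for all t ≥ 0. -/

import Mathlib

open Real Filter Set
open scoped Topology RealInnerProductSpace

noncomputable section
abbrev Vec (N : ℕ) := EuclideanSpace ℝ (Fin N)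

noncomputable def hessCLM {N : ℕ} (E : Vec N → ℝ) (x : Vec N) : Vec N →L[ℝ] Vec N :=
  fderiv ℝ (gradient E) x

noncomputable def hessOp {N : ℕ} (E : Vec N → ℝ) (x : Vec N) : Module.End ℝ (Vec N) :=
  (hessCLM E x).toLinearMap

def IsMinEigen {N : ℕ} (T : Module.End ℝ (Vec N)) (lam : ℝ) : Prop :=
  T.HasEigenvalue lam ∧ ∀ μ : ℝ, T.HasEigenvalue μ → lam ≤ μ

def IsMinEigvec {N : ℕ} (T : Module.End ℝ (Vec N)) (w : Vec N) : Prop :=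
  ‖w‖ = 1 ∧ ∃ lam : ℝ, IsMinEigen T lam ∧ T w = lam • w

def TwoSmallestEigen {N : ℕ} (T : Module.End ℝ (Vec N)) (lam1 lam2 : ℝ) : Prop :=
  T.HasEigenvalue lam1 ∧ T.HasEigenvalue lam2 ∧ lam1 ≤ lam2 ∧
    (∀ μ : ℝ, T.HasEigenvalue μ → lam1 ≤ μ) ∧
    (∀ μ : ℝ, T.HasEigenvalue μ → μ = lam1 ∨ lam2 ≤ μ) ∧
    (lam1 < lam2 → Module.finrank ℝ (T.eigenspace lam1) = 1)

/-- the reflection `(I - 2 w ⊗ w) u`. -/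
def reflect {N : ℕ} (w u : Vec N) : Vec N := u - (2 * ⟪w, u⟫) • w

/-- ISD vector field with eigendirection `w`. -/
noncomputable def isdField {N : ℕ} (E : Vec N → ℝ) (x w : Vec N) : Vec N :=
  -(reflect w (gradient E x))

def IsISDSolOn {N : ℕ} (E : Vec N → ℝ) (x : ℝ → Vec N) (s : Set ℝ) : Prop :=
  ∀ t ∈ s, ∃ w : Vec N, IsMinEigvec (hessOp E (x t)) w ∧
    HasDerivAt x (isdField E (x t) w) t

noncomputable def gadVField {N : ℕ} (E : Vec N → ℝ) (x v : Vec N) : Vec N :=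
  -(hessCLM E x v) + ⟪v, hessCLM E x v⟫ • v

def IsGADSolOn {N : ℕ} (E : Vec N → ℝ) (ε : ℝ) (x v : ℝ → Vec N) (s : Set ℝ) : Prop :=
  ∀ t ∈ s, ‖v t‖ = 1 ∧ HasDerivAt x (-(reflect (v t) (gradient E (x t)))) t ∧
    HasDerivAt v ((ε ^ 2)⁻¹ • gadVField E (x t) (v t)) t

def IsIndexOneSaddle {N : ℕ} (E : Vec N → ℝ) (x : Vec N) : Prop :=
  gradient E x = 0 ∧ ∃ lam1 lam2 : ℝ,
    TwoSmallestEigen (hessOp E x) lam1 lam2 ∧ lam1 < 0 ∧ 0 < lam2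

end

/-- spectral gap condition with eigenvector `w` -/
def GapAt {N : ℕ} (A : Vec N →L[ℝ] Vec N) (δ : ℝ) (w : Vec N) : Prop :=
  ‖w‖ = 1 ∧ (∃ b : ℝ, b ≤ -δ ∧ A w = b • w) ∧ ∀ u : Vec N, ⟪w, u⟫ = 0 → δ * ‖u‖ ^ 2 ≤ ⟪u, A u⟫

/-- quadratic form condition -/
def QuadAt {N : ℕ} (A : Vec N →L[ℝ] Vec N) (δ : ℝ) (v : Vec N) : Prop :=
  ‖v‖ = 1 ∧ ⟪v, A v⟫ ≤ -δ ∧ ∀ u : Vec N, ⟪v, u⟫ = 0 → δ * ‖u‖ ^ 2 ≤ ⟪u, A u⟫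

theorem quad_basis {N : ℕ} (T : Module.End ℝ (Vec N)) (hT : T.IsSymmetric) (c : ℝ) (u : Vec N)
    (h : ∀ (μ : ℝ) (e : Vec N), T.HasEigenvector μ e → ⟪e, u⟫ ≠ 0 → c ≤ μ) :
    c * ‖u‖ ^ 2 ≤ ⟪u, T u⟫ := by
  have hn : Module.finrank ℝ (Vec N) = N := by simp
  set e := hT.eigenvectorBasis hn with he
  have h1 : ⟪u, T u⟫ = ∑ i, hT.eigenvalues hn i * ⟪e i, u⟫ ^ 2 := by
    rw [← e.sum_inner_mul_inner]
    refine Finset.sum_congr rfl fun i _ => ?_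
    have : ⟪e i, T u⟫ = hT.eigenvalues hn i * ⟪e i, u⟫ := by
      rw [← hT (e i) u, he, hT.apply_eigenvectorBasis hn i, inner_smul_left]
      simp
    rw [this, real_inner_comm]
    ring
  have h2 : ‖u‖ ^ 2 = ∑ i, ⟪e i, u⟫ ^ 2 := by
    rw [← real_inner_self_eq_norm_sq, ← e.sum_inner_mul_inner]
    refine Finset.sum_congr rfl fun i _ => ?_
    rw [real_inner_comm]
    ring
  rw [h1, h2, Finset.mul_sum]
  refine Finset.sum_le_sum fun i _ => ?_
  by_cases h0 : ⟪e i, u⟫ = 0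
  · simp [h0]
  · exact mul_le_mul_of_nonneg_right
      (h _ _ (hT.hasEigenvector_eigenvectorBasis hn i) h0) (sq_nonneg _)

theorem gap_of_min {N : ℕ} {A : Vec N →L[ℝ] Vec N} (hA : A.toLinearMap.IsSymmetric) {δ : ℝ}
    (hδ : 0 < δ) {v w : Vec N} (hv : QuadAt A δ v) (hw : IsMinEigvec A.toLinearMap w) :
    GapAt A δ w := by
  obtain ⟨hw1, lam, ⟨hl, hmin⟩, hTw⟩ := hw
  have hTw' : A w = lam • w := hTw
  obtain ⟨hv1, hv2, hv3⟩ := hv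
  have hlam : lam ≤ -δ := by
    have := quad_basis A.toLinearMap hA lam v
      (fun μ e he _ => hmin μ (Module.End.hasEigenvalue_of_hasEigenvector he))
    rw [hv1] at this
    have h2 : ⟪v, A.toLinearMap v⟫ = ⟪v, A v⟫ := rfl
    linarith
  refine ⟨hw1, ⟨lam, hlam, hTw'⟩, fun u hu => ?_⟩
  have hww : ⟪w, A w⟫ = lam := by
    rw [hTw', inner_smul_right, real_inner_self_eq_norm_sq, hw1]; ring
  have hwu : ⟪w, A u⟫ = 0 := by
    have := hA w u
    have h3 : ⟪A w, u⟫ = ⟪w, A u⟫ := this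
    rw [← h3, hTw', inner_smul_left, hu]; simp
  have huw : ⟪u, A w⟫ = 0 := by
    rw [hTw', inner_smul_right, real_inner_comm, hu]; simp
  set α := ⟪v, w⟫ with hα
  set β := ⟪v, u⟫ with hβ
  have hα0 : α ≠ 0 := by
    intro h0
    have := hv3 w h0
    rw [hww, hw1] at this
    linarith
  have hz := hv3 (α • u - β • w) (by
    rw [inner_sub_right, inner_smul_right, inner_smul_right]; ring)
  have e1 : ⟪α • u - β • w, A (α • u - β • w)⟫ = α ^ 2 * ⟪u, A u⟫ + β ^ 2 * lam := by
    simp only [map_sub, map_smul, inner_sub_left, inner_sub_right, inner_smul_left,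
      inner_smul_right, hww, hwu, huw]
    simp; ring
  have e2 : ‖α • u - β • w‖ ^ 2 = α ^ 2 * ‖u‖ ^ 2 + β ^ 2 := by
    rw [← real_inner_self_eq_norm_sq]
    simp only [inner_sub_left, inner_sub_right, inner_smul_left,
      inner_smul_right, real_inner_self_eq_norm_sq, hw1, hu, real_inner_comm w u]
    simp; ring
  rw [e1, e2] at hz
  have hp : 0 < α ^ 2 := by positivity
  have : α ^ 2 * (δ * ‖u‖ ^ 2) ≤ α ^ 2 * ⟪u, A u⟫ := by
    nlinarith [sq_nonneg β]
  exact le_of_mul_le_mul_left this hp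

theorem exists_min {N : ℕ} {A : Vec N →L[ℝ] Vec N} (hA : A.toLinearMap.IsSymmetric) {δ : ℝ}
    {v : Vec N} (hv : QuadAt A δ v) : ∃ w, IsMinEigvec A.toLinearMap w := by
  have : Nontrivial (Vec N) := ⟨v, 0, fun h => by simpa [h] using hv.1⟩
  have hne : {μ : ℝ | Module.End.HasEigenvalue A.toLinearMap μ}.Nonempty :=
    ⟨_, hA.hasEigenvalue_iInf_of_finiteDimensional⟩
  have hfin : {μ : ℝ | Module.End.HasEigenvalue A.toLinearMap μ}.Finite :=
    Module.End.finite_hasEigenvalue _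
  obtain ⟨lam, hl, hmin⟩ := Set.exists_min_image _ id hfin hne
  obtain ⟨w, hw⟩ := Module.End.HasEigenvalue.exists_hasEigenvector hl
  have hw0 : ‖w‖ ≠ 0 := norm_ne_zero_iff.2 hw.2
  refine ⟨‖w‖⁻¹ • w, ?_, lam, ⟨hl, fun μ hμ => hmin μ hμ⟩, ?_⟩
  · rw [norm_smul, norm_inv, norm_norm, inv_mul_cancel₀ hw0]
  · rw [map_smul, hw.apply_eq_smul, smul_comm]

theorem quad_of_two {N : ℕ} {A : Vec N →L[ℝ] Vec N} (hA : A.toLinearMap.IsSymmetric) {l1 l2 : ℝ}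
    (h : TwoSmallestEigen A.toLinearMap l1 l2) (h1 : l1 < 0) (h2 : 0 < l2) :
    ∃ δ > 0, ∃ v, QuadAt A δ v := by
  obtain ⟨he1, he2, -, -, hdich, hfin⟩ := h
  have hfin := hfin (h1.trans h2)
  obtain ⟨w, hw⟩ := Module.End.HasEigenvalue.exists_hasEigenvector he1
  have hw0 : ‖w‖ ≠ 0 := norm_ne_zero_iff.2 hw.2
  have hAw : A w = l1 • w := hw.apply_eq_smul
  refine ⟨min (-l1) l2, lt_min (by linarith) h2, ‖w‖⁻¹ • w, ?_, ?_, ?_⟩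
  · rw [norm_smul, norm_inv, norm_norm, inv_mul_cancel₀ hw0]
  · have : ⟪‖w‖⁻¹ • w, A (‖w‖⁻¹ • w)⟫ = l1 := by
      rw [map_smul, hAw, inner_smul_left, inner_smul_right, inner_smul_right,
        real_inner_self_eq_norm_sq]
      simp; field_simp
    rw [this]
    have := min_le_left (-l1) l2
    linarith
  · intro u hu
    have hu' : ⟪w, u⟫ = 0 := by
      rw [inner_smul_left] at hu
      simpa [hw.2] using hu
    have := quad_basis A.toLinearMap hA l2 u (fun μ e he hne => by
      rcases hdich μ (Module.End.hasEigenvalue_of_hasEigenvector he) with h | h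
      · exfalso
        subst h
        have hs := (finrank_eq_one_iff_of_nonzero' (⟨w, hw.1⟩ : Module.End.eigenspace A.toLinearMap μ)
          (by simpa [Subtype.ext_iff] using hw.2)).1 hfin ⟨e, he.1⟩
        obtain ⟨c, hc⟩ := hs
        have hc' : c • w = e := congrArg Subtype.val hc
        apply hne
        rw [← hc', inner_smul_left, hu', mul_zero]
      · exact h)
    refine le_trans ?_ this
    exact mul_le_mul_of_nonneg_right (min_le_right _ _) (sq_nonneg _)

theorem quad_pert {N : ℕ} {A B : Vec N →L[ℝ] Vec N} {δ : ℝ} {v : Vec N} (h : QuadAt A δ v)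
    (hAB : ‖B - A‖ ≤ δ / 2) : QuadAt B (δ / 2) v := by
  have key : ∀ u : Vec N, |⟪u, B u⟫ - ⟪u, A u⟫| ≤ δ / 2 * ‖u‖ ^ 2 := by
    intro u
    have : ⟪u, B u⟫ - ⟪u, A u⟫ = ⟪u, (B - A) u⟫ := by
      rw [_root_.sub_apply, inner_sub_right]
    rw [this]
    calc |⟪u, (B - A) u⟫| ≤ ‖u‖ * ‖(B - A) u‖ := abs_real_inner_le_norm _ _
      _ ≤ ‖u‖ * (δ / 2 * ‖u‖) := by
        gcongr; exact (B - A).le_of_opNorm_le hAB u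
      _ = _ := by ring
  obtain ⟨h1, h2, h3⟩ := h
  refine ⟨h1, ?_, fun u hu => ?_⟩
  · have := (abs_le.1 (key v)).2
    rw [h1] at this
    linarith
  · have := (abs_le.1 (key u)).1
    have := h3 u hu
    linarith

theorem reflect_norm {N : ℕ} {w : Vec N} (hw : ‖w‖ = 1) (g : Vec N) : ‖reflect w g‖ = ‖g‖ := by
  rw [← sq_eq_sq₀ (norm_nonneg _) (norm_nonneg _), ← real_inner_self_eq_norm_sq,
    ← real_inner_self_eq_norm_sq, reflect]
  simp only [inner_sub_left, inner_sub_right, inner_smul_left,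
      inner_smul_right, real_inner_self_eq_norm_sq w, hw, real_inner_comm w g]
  simp; ring

theorem reflect_neg {N : ℕ} (w g : Vec N) : reflect (-w) g = reflect w g := by
  simp [reflect]

theorem reflect_lip {N : ℕ} {A B : Vec N →L[ℝ] Vec N}
    {δ : ℝ} (hδ : 0 < δ) {v w : Vec N} (hv : GapAt A δ v) (hw : GapAt B δ w) (g : Vec N) :
    ‖reflect v g - reflect w g‖ ≤ 8 / δ * ‖A - B‖ * ‖g‖ := by
  wlog hc : 0 ≤ ⟪w, v⟫ generalizing w
  · have := @this (-w) ⟨by simpa using hw.1, ?_, fun u hu => hw.2.2 u (by simpa using hu)⟩ ?_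
    · rwa [reflect_neg] at this
    · obtain ⟨b, hb, hb'⟩ := hw.2.1
      exact ⟨b, hb, by rw [map_neg, hb', smul_neg]⟩
    · rw [inner_neg_left]; linarith
  obtain ⟨hv1, ⟨a, ha, hav⟩, -⟩ := hv
  obtain ⟨hw1, ⟨b, hb, hbw⟩, hw3⟩ := hw
  set c := ⟪w, v⟫ with hcdef
  set u := v - c • w with hu
  have hwu : ⟪w, u⟫ = 0 := by
    rw [hu, inner_sub_right, inner_smul_right, real_inner_self_eq_norm_sq, hw1]; simp [c]
  have hv' : v = u + c • w := by simp [hu]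
  have hnu : ‖u‖ ^ 2 = 1 - c ^ 2 := by
    rw [← real_inner_self_eq_norm_sq, hu]
    simp only [inner_sub_left, inner_sub_right, inner_smul_left, inner_smul_right,
      real_inner_self_eq_norm_sq, hw1, hv1, real_inner_comm w v, ← hcdef]
    simp; ring
  have huv : ⟪u, v⟫ = ‖u‖ ^ 2 := by
    conv_lhs => rw [hv', inner_add_right, inner_smul_right, real_inner_comm w u, hwu,
      real_inner_self_eq_norm_sq]
    ring
  have hm : ⟪u, (A - B) v⟫ = a * ‖u‖ ^ 2 - ⟪u, B u⟫ := by
    rw [_root_.sub_apply, inner_sub_right, hav, inner_smul_right, huv]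
    congr 1
    conv_lhs => rw [hv', map_add, map_smul, hbw, inner_add_right, inner_smul_right,
      inner_smul_right, real_inner_comm w u, hwu]
    simp
  have hle : |⟪u, (A - B) v⟫| ≤ ‖u‖ * ‖A - B‖ := by
    refine (abs_real_inner_le_norm _ _).trans ?_
    gcongr
    simpa [hv1] using (A - B).le_opNorm v
  have hub := hw3 u hwu
  have h5 : δ * ‖u‖ ^ 2 ≤ ‖u‖ * ‖A - B‖ := by
    have := (abs_le.1 hle).1
    rw [hm] at this
    nlinarith [sq_nonneg ‖u‖]
  have h6 : ‖u‖ ≤ ‖A - B‖ / δ := by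
    rw [le_div_iff₀ hδ]
    rcases (norm_nonneg u).eq_or_lt with h | h
    · rw [← h]; simp
    · nlinarith
  have hc1 : c ≤ 1 := by nlinarith [sq_nonneg ‖u‖]
  have hu1 : ‖u‖ ≤ 1 := by nlinarith [norm_nonneg u]
  have h7 : ‖v - w‖ ≤ 2 * ‖u‖ := by
    have : v - w = u - (1 - c) • w := by rw [hu, sub_smul, one_smul]; abel
    rw [this]
    refine (norm_sub_le _ _).trans ?_
    rw [norm_smul, hw1, Real.norm_eq_abs, abs_of_nonneg (by linarith)]
    nlinarith [norm_nonneg u]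
  have h8 : reflect v g - reflect w g = -((2 * ⟪v - w, g⟫) • v + (2 * ⟪w, g⟫) • (v - w)) := by
    simp only [reflect, inner_sub_left]
    module
  rw [h8, norm_neg]
  have i1 : |⟪v - w, g⟫| ≤ ‖v - w‖ * ‖g‖ := abs_real_inner_le_norm _ _
  have i2 : |⟪w, g⟫| ≤ ‖g‖ := by simpa [hw1] using abs_real_inner_le_norm w g
  calc _ ≤ 2 * |⟪v - w, g⟫| * ‖v‖ + 2 * |⟪w, g⟫| * ‖v - w‖ := by
        refine (norm_add_le _ _).trans ?_
        rw [norm_smul, norm_smul, norm_mul, norm_mul]; simp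
    _ ≤ 2 * (‖v - w‖ * ‖g‖) * 1 + 2 * ‖g‖ * ‖v - w‖ := by rw [hv1]; gcongr
    _ = 4 * ‖v - w‖ * ‖g‖ := by ring
    _ ≤ 4 * (2 * (‖A - B‖ / δ)) * ‖g‖ := by gcongr; linarith
    _ = _ := by ring

theorem gap_diss {N : ℕ} {A : Vec N →L[ℝ] Vec N} (hA : A.toLinearMap.IsSymmetric)
    {δ : ℝ} {w : Vec N} (hw : GapAt A δ w) (g : Vec N) :
    δ * ‖g‖ ^ 2 ≤ ⟪g, A (reflect w g)⟫ := by
  obtain ⟨hw1, ⟨b, hb, hbw⟩, hw3⟩ := hw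
  set α := ⟪w, g⟫ with hα
  set u := g - α • w with hu
  have hwu : ⟪w, u⟫ = 0 := by
    rw [hu, inner_sub_right, inner_smul_right, real_inner_self_eq_norm_sq, hw1]; simp [α]
  have hg : g = u + α • w := by simp [hu]
  have hr : reflect w g = u - α • w := by rw [reflect, hu, ← hα]; module
  have hwAu : ⟪w, A u⟫ = 0 := by
    have h3 : ⟪A w, u⟫ = ⟪w, A u⟫ := hA w u
    rw [← h3, hbw, inner_smul_left, hwu]; simp
  have e1 : ⟪g, A (reflect w g)⟫ = ⟪u, A u⟫ - α ^ 2 * b := by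
    rw [hr]
    conv_lhs => rw [hg]
    simp only [map_sub, map_smul, hbw, inner_add_left, inner_sub_right, inner_smul_left,
      inner_smul_right, hwAu, real_inner_self_eq_norm_sq w, hw1, real_inner_comm w u, hwu]
    simp; ring
  have e2 : ‖g‖ ^ 2 = ‖u‖ ^ 2 + α ^ 2 := by
    conv_lhs => rw [← real_inner_self_eq_norm_sq, hg]
    simp only [inner_add_left, inner_add_right, inner_smul_left,
      inner_smul_right, real_inner_self_eq_norm_sq, hw1, real_inner_comm w u, hwu]
    simp; ring
  rw [e1, e2]
  nlinarith [hw3 u hwu, sq_nonneg α]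

theorem clip_lip (a b : ℝ) : |max 0 (min 1 a) - max 0 (min 1 b)| ≤ |a - b| := by
  grind

theorem grad_contDiff {N : ℕ} {E : Vec N → ℝ} (hE : ContDiff ℝ 3 E) :
    ContDiff ℝ 2 (gradient E) := by
  have h1 : ContDiff ℝ 2 (fderiv ℝ E) := hE.fderiv_right (by norm_num)
  exact (InnerProductSpace.toDual ℝ (Vec N)).symm.toContinuousLinearEquiv.contDiff.comp h1

theorem hess_contDiff {N : ℕ} {E : Vec N → ℝ} (hE : ContDiff ℝ 3 E) :
    ContDiff ℝ 1 (hessCLM E) :=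
  (grad_contDiff hE).fderiv_right (by norm_num)

theorem hess_symm {N : ℕ} {E : Vec N → ℝ} (hE : ContDiff ℝ 3 E) (x : Vec N) :
    (hessCLM E x).toLinearMap.IsSymmetric := by
  have hs : IsSymmSndFDerivAt ℝ E x :=
    hE.contDiffAt.isSymmSndFDerivAt (by simp; norm_num)
  have h1 : Differentiable ℝ (fderiv ℝ E) :=
    (hE.fderiv_right (m := 2) (by norm_num)).differentiable (by norm_num)
  have key : ∀ v u : Vec N, ⟪hessCLM E x v, u⟫ = fderiv ℝ (fderiv ℝ E) x v u := by
    intro v u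
    have hg : HasFDerivAt (gradient E) (hessCLM E x) x :=
      ((grad_contDiff hE).differentiable (by norm_num) x).hasFDerivAt
    have h2 := hg.inner ℝ (hasFDerivAt_const u x)
    have h3 := (h1 x).hasFDerivAt.clm_apply (hasFDerivAt_const u x)
    have h4 : (fun y => ⟪gradient E y, u⟫) = fun y => fderiv ℝ E y u := by
      funext y
      exact InnerProductSpace.toDual_symm_apply
    rw [h4] at h2
    have h5 := congrArg (fun L : Vec N →L[ℝ] ℝ => L v) (h2.unique h3)
    simpa using h5
  intro v u
  change ⟪hessCLM E x v, u⟫ = ⟪v, hessCLM E x u⟫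
  rw [key, real_inner_comm, key]
  exact hs v u

open scoped NNReal in
theorem global_ode {N : ℕ} (G : Vec N → Vec N) (K M : ℝ≥0) (hG : LipschitzWith K G)
    (hM : ∀ x, ‖G x‖ ≤ M) (x0 : Vec N) :
    ∃ x : ℝ → Vec N, x 0 = x0 ∧ ∀ t, HasDerivAt x (G (x t)) t := by
  have hloc : ∀ n : ℕ, ∃ x : ℝ → Vec N, x 0 = x0 ∧
      ∀ t ∈ Ioo (-(n + 1 : ℝ)) (n + 1), HasDerivAt x (G (x t)) t := by
    intro n
    have hn : (0:ℝ) ∈ Icc (-(n + 1 : ℝ)) (n + 1) := by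
      constructor <;> linarith [(n.cast_nonneg : (0:ℝ) ≤ n)]
    have hp : IsPicardLindelof (fun _ => G) (⟨0, hn⟩ : Icc (-(n + 1 : ℝ)) (n + 1)) x0
        (M * (n + 1)) 0 M K :=
      { lipschitzOnWith := fun t _ => hG.lipschitzOnWith
        continuousOn := fun x _ => continuousOn_const
        norm_le := fun t _ x _ => hM x
        mul_max_le := by simp }
    obtain ⟨α, h0, h1⟩ := hp.exists_eq_forall_mem_Icc_hasDerivWithinAt₀
    exact ⟨α, h0, fun t ht => (h1 t (Ioo_subset_Icc_self ht)).hasDerivAt (Icc_mem_nhds ht.1 ht.2)⟩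
  choose X hX0 hX using hloc
  have huniq : ∀ m n : ℕ, m ≤ n → EqOn (X m) (X n) (Ioo (-(m + 1 : ℝ)) (m + 1)) := by
    intro m n hmn
    have hmn' : (m : ℝ) ≤ n := by exact_mod_cast hmn
    have hm0 : (0:ℝ) ≤ m := m.cast_nonneg
    refine ODE_solution_unique_of_mem_Ioo (v := fun _ => G) (s := fun _ => univ) (K := K) (t₀ := 0)
      (fun t _ => hG.lipschitzOnWith) ⟨by linarith, by linarith⟩
      (fun t ht => ⟨hX m t ht, mem_univ _⟩)
      (fun t ht => ⟨hX n t ⟨by linarith [ht.1], by linarith [ht.2]⟩, mem_univ _⟩) ?_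
    rw [hX0, hX0]
  have hall : ∀ (n : ℕ) (t : ℝ), |t| < n + 1 → X ⌈|t|⌉₊ t = X n t := by
    intro n t ht
    have h1 : |t| < (⌈|t|⌉₊ : ℝ) + 1 := by linarith [Nat.le_ceil |t|]
    rcases le_total ⌈|t|⌉₊ n with h | h
    · exact huniq _ _ h (abs_lt.1 h1)
    · exact (huniq _ _ h (abs_lt.1 ht)).symm
  refine ⟨fun t => X ⌈|t|⌉₊ t, by simp [hX0], fun t => ?_⟩
  set n := ⌈|t|⌉₊
  have h1 : |t| < (n : ℝ) + 1 := by linarith [Nat.le_ceil |t|]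
  refine (hX n t (abs_lt.1 h1)).congr_of_eventuallyEq ?_
  filter_upwards [(continuous_abs.isOpen_preimage _ isOpen_Iio).mem_nhds
    (show t ∈ abs ⁻¹' Iio ((n:ℝ) + 1) from h1)] with s hs
  exact hall n s hs

theorem exists_nbhd {N : ℕ} {E : Vec N → ℝ} (hE : ContDiff ℝ 3 E) {Ω : Set (Vec N)}
    (hΩ : IsCompact Ω)
    (h : ∀ x ∈ Ω, ∃ δ > 0, ∃ v, QuadAt (hessCLM E x) δ v) :
    ∃ δ > 0, ∃ U, IsOpen U ∧ Ω ⊆ U ∧ ∀ x ∈ U, ∃ v, QuadAt (hessCLM E x) δ v := by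
  have mono : ∀ {A : Vec N →L[ℝ] Vec N} {δ δ' : ℝ} {v : Vec N}, δ' ≤ δ → QuadAt A δ v →
      QuadAt A δ' v := by
    intro A δ δ' v hd ⟨h1, h2, h3⟩
    exact ⟨h1, by linarith, fun u hu => le_trans (by gcongr) (h3 u hu)⟩
  refine hΩ.induction_on (p := fun s => ∃ δ > 0, ∃ U, IsOpen U ∧ s ⊆ U ∧
    ∀ x ∈ U, ∃ v, QuadAt (hessCLM E x) δ v) ?_ ?_ ?_ ?_
  · exact ⟨1, one_pos, ∅, isOpen_empty, subset_rfl, by simp⟩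
  · rintro s t hst ⟨δ, hδ, U, hU, htU, h⟩
    exact ⟨δ, hδ, U, hU, hst.trans htU, h⟩
  · rintro s t ⟨δ, hδ, U, hU, htU, h⟩ ⟨δ', hδ', U', hU', htU', h'⟩
    refine ⟨min δ δ', lt_min hδ hδ', U ∪ U', hU.union hU', union_subset_union htU htU', ?_⟩
    rintro x (hx | hx)
    · obtain ⟨v, hv⟩ := h x hx
      exact ⟨v, mono (min_le_left _ _) hv⟩
    · obtain ⟨v, hv⟩ := h' x hx
      exact ⟨v, mono (min_le_right _ _) hv⟩
  · intro x hx
    obtain ⟨δ, hδ, v, hv⟩ := h x hx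
    have hc : Continuous (hessCLM E) := (hess_contDiff hE).continuous
    set U := {y | ‖hessCLM E y - hessCLM E x‖ < δ / 2} with hUdef
    have hU : IsOpen U := isOpen_lt (by fun_prop) continuous_const
    have hxU : x ∈ U := by simp [hUdef, hδ]
    exact ⟨U, mem_nhdsWithin_of_mem_nhds (hU.mem_nhds hxU), δ / 2, by positivity, U, hU,
      subset_rfl, fun y hy => ⟨v, quad_pert hv (le_of_lt hy)⟩⟩

theorem reflect_sub {N : ℕ} (w a b : Vec N) : reflect w a - reflect w b = reflect w (a - b) := by
  simp only [reflect, inner_sub_right]; module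

open scoped NNReal in
theorem exists_field {N : ℕ} {E : Vec N → ℝ} (hE : ContDiff ℝ 3 E) {Ω : Set (Vec N)}
    (hΩ : IsCompact Ω) (hne : Ω.Nonempty)
    (h : ∀ x ∈ Ω, ∃ δ > 0, ∃ v, QuadAt (hessCLM E x) δ v) :
    ∃ δ > 0, ∃ V, IsOpen V ∧ Ω ⊆ V ∧ ∃ (G : Vec N → Vec N) (K M : ℝ≥0), LipschitzWith K G ∧
      (∀ x, ‖G x‖ ≤ M) ∧
      (∀ x ∈ V, ∀ w, IsMinEigvec (hessOp E x) w →
        G x = isdField E x w ∧ GapAt (hessCLM E x) δ w) ∧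
      (∀ x ∈ V, ∃ w, IsMinEigvec (hessOp E x) w) ∧
      (∀ x, ⟪gradient E x, hessCLM E x (G x)⟫ ≤ 0) := by
  obtain ⟨δ, hδ, U, hU, hΩU, hquad⟩ := exists_nbhd hE hΩ h
  obtain ⟨r, hr, hrU⟩ := hΩ.exists_cthickening_subset_open hU hΩU
  set W := Metric.cthickening r Ω with hW
  have hWc : IsCompact W := hΩ.cthickening
  have hthick : Metric.thickening r Ω ⊆ W := Metric.thickening_subset_cthickening _ _
  have hmin : ∀ x ∈ W, ∃ w, IsMinEigvec (hessOp E x) w := by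
    intro x hx
    obtain ⟨v, hv⟩ := hquad x (hrU hx)
    exact exists_min (hess_symm hE x) hv
  have hgap : ∀ x ∈ W, ∀ w, IsMinEigvec (hessOp E x) w → GapAt (hessCLM E x) δ w := by
    intro x hx w hw
    obtain ⟨v, hv⟩ := hquad x (hrU hx)
    exact gap_of_min (hess_symm hE x) hδ hv hw
  have hwx : ∀ x, ∃ w, x ∈ W → IsMinEigvec (hessOp E x) w := by
    intro x
    by_cases hx : x ∈ W
    · obtain ⟨w, hw⟩ := hmin x hx
      exact ⟨w, fun _ => hw⟩
    · exact ⟨0, fun h => absurd h hx⟩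
  choose w hw using hwx
  set g := gradient E with hg
  obtain ⟨Kg, hKg⟩ := ((grad_contDiff hE).of_le
    (by norm_num : (1 : WithTop ℕ∞) ≤ 2)).locallyLipschitz.locallyLipschitzOn
      (s := W) |>.exists_lipschitzOnWith_of_compact hWc
  obtain ⟨KH, hKH⟩ := (hess_contDiff hE).locallyLipschitz.locallyLipschitzOn
      (s := W) |>.exists_lipschitzOnWith_of_compact hWc
  obtain ⟨C, hC⟩ := hWc.exists_bound_of_continuousOn (f := g)
    (grad_contDiff hE).continuous.continuousOn
  have hC0 : 0 ≤ C := by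
    obtain ⟨z, hz⟩ := hne
    exact (norm_nonneg _).trans (hC z (Metric.self_subset_cthickening _ hz))
  set F : Vec N → Vec N := fun x => isdField E x (w x) with hF
  have hFn : ∀ x ∈ W, ‖F x‖ ≤ C := by
    intro x hx
    rw [hF]
    simp only [isdField, norm_neg]
    rw [reflect_norm (hw x hx).1]
    exact hC x hx
  have hFl : ∀ x ∈ W, ∀ y ∈ W, ‖F x - F y‖ ≤ (Kg + 8 / δ * KH * C) * dist x y := by
    intro x hx y hy
    have e : F x - F y = -(reflect (w x) (g x - g y) +
        (reflect (w x) (g y) - reflect (w y) (g y))) := by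
      rw [← reflect_sub]; simp only [hF, isdField, hg]; abel
    rw [e, norm_neg]
    refine (norm_add_le _ _).trans ?_
    rw [reflect_norm (hw x hx).1]
    have i1 : ‖g x - g y‖ ≤ Kg * dist x y := by
      rw [← dist_eq_norm]; exact hKg.dist_le_mul x hx y hy
    have i2 : ‖hessCLM E x - hessCLM E y‖ ≤ KH * dist x y := by
      rw [← dist_eq_norm]; exact hKH.dist_le_mul x hx y hy
    have i3 := reflect_lip hδ (hgap x hx _ (hw x hx)) (hgap y hy _ (hw y hy)) (g y)
    calc _ ≤ Kg * dist x y + 8 / δ * (KH * dist x y) * C := by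
          refine add_le_add i1 (i3.trans ?_)
          gcongr
          exact hC y hy
      _ = _ := by ring
  set χ : Vec N → ℝ := fun x => max 0 (min 1 (2 - 2 / r * Metric.infDist x Ω)) with hχ
  have hχ0 : ∀ x, 0 ≤ χ x := fun x => le_max_left _ _
  have hχ1 : ∀ x, χ x ≤ 1 := fun x => max_le zero_le_one (min_le_left _ _)
  have hχl : ∀ x y, |χ x - χ y| ≤ 2 / r * dist x y := by
    intro x y
    refine (clip_lip _ _).trans ?_
    have h2 : |Metric.infDist y Ω - Metric.infDist x Ω| ≤ dist x y := by
      rw [dist_comm]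
      have := (Metric.lipschitz_infDist_pt Ω).dist_le_mul y x
      simpa [Real.dist_eq] using this
    have h3 : (2 - 2 / r * Metric.infDist x Ω) - (2 - 2 / r * Metric.infDist y Ω)
      = 2 / r * (Metric.infDist y Ω - Metric.infDist x Ω) := by ring
    rw [h3, abs_mul, abs_of_pos (by positivity : 0 < 2 / r)]
    gcongr
  have hχout : ∀ x, x ∉ W → χ x = 0 := by
    intro x hx
    have h1 : ¬ Metric.infDist x Ω < r := fun h =>
      hx (hthick ((Metric.mem_thickening_iff_infDist_lt hne).2 h))
    have h2 : 2 ≤ 2 / r * Metric.infDist x Ω := by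
      calc (2:ℝ) = 2 / r * r := by field_simp
        _ ≤ _ := by gcongr; exact not_lt.1 h1
    apply max_eq_left
    exact (min_le_right _ _).trans (by linarith)
  have hGl : ∀ x y, ‖χ x • F x - χ y • F y‖ ≤
      ((Kg + 8 / δ * KH * C) + 2 / r * C) * dist x y := by
    have half : ∀ x ∈ W, ∀ y, y ∉ W → ‖χ x • F x - χ y • F y‖ ≤
      ((Kg + 8 / δ * KH * C) + 2 / r * C) * dist x y := by
      intro x hx y hy
      have h1 := hχl x y
      rw [hχout y hy, sub_zero] at h1
      rw [hχout y hy, zero_smul, sub_zero, norm_smul, Real.norm_eq_abs]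
      calc |χ x| * ‖F x‖ ≤ (2 / r * dist x y) * C := by
            gcongr; exact hFn x hx
        _ ≤ _ := by
            have : 0 ≤ (Kg + 8 / δ * KH * C) * dist x y := by positivity
            nlinarith
    intro x y
    by_cases hx : x ∈ W <;> by_cases hy : y ∈ W
    · have e : χ x • F x - χ y • F y = χ x • (F x - F y) + (χ x - χ y) • F y := by module
      rw [e]
      refine (norm_add_le _ _).trans ?_
      rw [norm_smul, norm_smul, Real.norm_eq_abs, Real.norm_eq_abs, abs_of_nonneg (hχ0 x)]
      calc _ ≤ 1 * ((Kg + 8 / δ * KH * C) * dist x y) + (2 / r * dist x y) * C := by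
            gcongr
            · exact hχ1 x
            · exact hFl x hx y hy
            · exact hχl x y
            · exact hFn y hy
        _ = _ := by ring
    · exact half x hx y hy
    · rw [norm_sub_rev, dist_comm]; exact half y hy x hx
    · rw [hχout x hx, hχout y hy]; simp; positivity
  refine ⟨δ, hδ, Metric.thickening (r / 2) Ω, Metric.isOpen_thickening,
    Metric.self_subset_thickening (by positivity) _, fun x => χ x • F x,
    ⟨(Kg + 8 / δ * KH * C) + 2 / r * C, by positivity⟩, ⟨C, hC0⟩, ?_, ?_, ?_, ?_, ?_⟩
  · refine LipschitzWith.of_dist_le_mul fun x y => ?_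
    rw [dist_eq_norm]
    exact hGl x y
  · intro x
    by_cases hx : x ∈ W
    · rw [norm_smul, Real.norm_eq_abs, abs_of_nonneg (hχ0 x)]
      calc _ ≤ 1 * C := by
            gcongr
            · exact hχ1 x
            · exact hFn x hx
        _ = C := one_mul _
    · show ‖χ x • F x‖ ≤ C
      rw [hχout x hx, zero_smul, norm_zero]
      exact hC0
  · intro x hx w' hw'
    have hxW : x ∈ W := hthick (Metric.thickening_mono (by linarith) _ hx)
    have hd := (Metric.mem_thickening_iff_infDist_lt hne).1 hx
    have hone : χ x = 1 := by
      have h2 : 2 / r * Metric.infDist x Ω ≤ 1 := by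
        calc _ ≤ 2 / r * (r / 2) := by gcongr
          _ = 1 := by field_simp
      simp only [hχ]
      rw [min_eq_left (by linarith), max_eq_right zero_le_one]
    refine ⟨?_, hgap x hxW w' hw'⟩
    have := reflect_lip hδ (hgap x hxW _ (hw x hxW)) (hgap x hxW _ hw') (g x)
    simp only [sub_self, norm_zero, mul_zero, zero_mul] at this
    have := sub_eq_zero.1 (norm_le_zero_iff.1 this)
    simp only [hone, one_smul, hF, isdField]
    rw [this]
  · intro x hx
    exact hmin x (hthick (Metric.thickening_mono (by linarith) _ hx))
  · intro x
    by_cases hx : x ∈ W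
    · have := gap_diss (hess_symm hE x) (hgap x hx _ (hw x hx)) (g x)
      have h2 : 0 ≤ ⟪g x, hessCLM E x (reflect (w x) (g x))⟫ := le_trans (by positivity) this
      simp only [hF, isdField, map_smul, map_neg, inner_smul_right, inner_neg_right]
      have := mul_nonneg (hχ0 x) h2
      linarith
    · simp [hχout x hx]

/-- If `Ω` is a bounded closed connected component of
`{‖∇E‖ ≤ L}` on which `λ1 < 0 < λ2`, then from any `x0 ∈ Ω` the ISD has a unique global
solution staying in `Ω`, which converges exponentially to an index-1 saddle in `Ω`. -/
theorem stmt3 {N : ℕ} (E : Vec N → ℝ) (hE : ContDiff ℝ 3 E) (L : ℝ) (hL : 0 < L)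
    (Ω : Set (Vec N))
    (hcomp : ∃ y ∈ {x : Vec N | ‖gradient E x‖ ≤ L},
      Ω = connectedComponentIn {x : Vec N | ‖gradient E x‖ ≤ L} y)
    (hclosed : IsClosed Ω) (hbdd : Bornology.IsBounded Ω)
    (lam1 lam2 : Vec N → ℝ)
    (heig : ∀ x ∈ Ω, TwoSmallestEigen (hessOp E x) (lam1 x) (lam2 x) ∧
      lam1 x < 0 ∧ 0 < lam2 x) :
    ∀ x0 ∈ Ω, ∃ x : ℝ → Vec N, x 0 = x0 ∧
      (∀ t ∈ Ici (0:ℝ), x t ∈ Ω) ∧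
      ContDiffOn ℝ 1 x (Ici 0) ∧
      IsISDSolOn E x (Ici 0) ∧
      (∀ y : ℝ → Vec N, y 0 = x0 → IsISDSolOn E y (Ici 0) →
        ∀ t ∈ Ici (0:ℝ), y t = x t) ∧
      ∃ xstar ∈ Ω, IsIndexOneSaddle E xstar ∧
        ∃ K c : ℝ, 0 < K ∧ 0 < c ∧
          ∀ t ∈ Ici (0:ℝ), ‖x t - xstar‖ ≤ K * Real.exp (-c * t) := by
  intro x0 hx0
  obtain ⟨y0, hy0, hΩ⟩ := hcomp
  have hΩc : IsCompact Ω := Metric.isCompact_of_isClosed_isBounded hclosed hbdd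
  have hΩS : Ω ⊆ {x : Vec N | ‖gradient E x‖ ≤ L} := by
    rw [hΩ]; exact connectedComponentIn_subset _ _
  have hΩ0 : Ω = connectedComponentIn {x : Vec N | ‖gradient E x‖ ≤ L} x0 := by
    rw [hΩ] at hx0 ⊢
    exact connectedComponentIn_eq hx0
  obtain ⟨δ, hδ, V, hV, hΩV, G, K, M, hGl, hGM, hGV, hex, hdiss⟩ :=
    exists_field hE hΩc ⟨x0, hx0⟩ (fun x hx => by
      obtain ⟨h1, h2, h3⟩ := heig x hx
      exact quad_of_two (hess_symm hE x) h1 h2 h3)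
  obtain ⟨x, hx00, hx⟩ := global_ode G K M hGl hGM x0
  have hxc : Continuous x := continuous_iff_continuousAt.2 fun t => (hx t).continuousAt
  have hf : ∀ t, HasDerivAt (fun t => ‖gradient E (x t)‖ ^ 2)
      (2 * ⟪gradient E (x t), hessCLM E (x t) (G (x t))⟫) t := by
    intro t
    have hg : HasFDerivAt (gradient E) (hessCLM E (x t)) (x t) :=
      ((grad_contDiff hE).differentiable (by norm_num) (x t)).hasFDerivAt
    exact (hg.comp_hasDerivAt t (hx t)).norm_sq
  have hanti : Antitone (fun t => ‖gradient E (x t)‖ ^ 2) := by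
    refine antitone_of_deriv_nonpos (fun t => (hf t).differentiableAt) fun t => ?_
    rw [(hf t).deriv]
    linarith [hdiss (x t)]
  have hmem : ∀ t ∈ Ici (0:ℝ), x t ∈ Ω := by
    intro t ht
    have hsub : x '' Icc 0 t ⊆ {x : Vec N | ‖gradient E x‖ ≤ L} := by
      rintro _ ⟨s, hs, rfl⟩
      have h1 := hanti hs.1
      simp only [hx00] at h1
      have h2 : ‖gradient E x0‖ ≤ L := hΩS hx0
      exact ((pow_le_pow_iff_left₀ (norm_nonneg _) (norm_nonneg _) two_ne_zero).1 h1).trans h2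
    have hpre : IsPreconnected (x '' Icc 0 t) :=
      isPreconnected_Icc.image x hxc.continuousOn
    have h0 : x0 ∈ x '' Icc 0 t := ⟨0, ⟨le_rfl, ht⟩, hx00⟩
    rw [hΩ0]
    exact hpre.subset_connectedComponentIn h0 hsub ⟨t, ⟨ht, le_rfl⟩, rfl⟩
  have hsol : ∀ t ∈ Ici (0:ℝ), ∃ w, IsMinEigvec (hessOp E (x t)) w ∧
      G (x t) = isdField E (x t) w ∧ GapAt (hessCLM E (x t)) δ w := by
    intro t ht
    obtain ⟨w, hw⟩ := hex (x t) (hΩV (hmem t ht))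
    exact ⟨w, hw, hGV (x t) (hΩV (hmem t ht)) w hw⟩
  have hdecay : ∀ t ∈ Ici (0:ℝ), ‖gradient E (x t)‖ ≤ L * Real.exp (-δ * t) := by
    have hh : ∀ t, HasDerivAt (fun t => ‖gradient E (x t)‖ ^ 2 * Real.exp (2 * δ * t))
        (2 * ⟪gradient E (x t), hessCLM E (x t) (G (x t))⟫ * Real.exp (2 * δ * t) +
          ‖gradient E (x t)‖ ^ 2 * (Real.exp (2 * δ * t) * (2 * δ * 1))) t := by
      intro t
      exact (hf t).mul (((hasDerivAt_id t).const_mul (2 * δ)).exp)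
    have ha : AntitoneOn (fun t => ‖gradient E (x t)‖ ^ 2 * Real.exp (2 * δ * t)) (Ici 0) := by
      refine antitoneOn_of_deriv_nonpos (convex_Ici 0)
        (fun t _ => (hh t).continuousAt.continuousWithinAt)
        (fun t _ => (hh t).differentiableAt.differentiableWithinAt) fun t ht => ?_
      rw [(hh t).deriv]
      have ht' : t ∈ Ici (0:ℝ) := interior_subset ht
      obtain ⟨w, hw, hG, hgap⟩ := hsol t ht'
      have h1 := gap_diss (hess_symm hE (x t)) hgap (gradient E (x t))
      have h2 : ⟪gradient E (x t), hessCLM E (x t) (G (x t))⟫ =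
          -⟪gradient E (x t), hessCLM E (x t) (reflect w (gradient E (x t)))⟫ := by
        rw [hG, isdField, map_neg, inner_neg_right]
      rw [h2]
      have := Real.exp_pos (2 * δ * t)
      nlinarith
    intro t ht
    have h1 := ha (mem_Ici.2 le_rfl) ht ht
    simp only [hx00, mul_zero, Real.exp_zero, mul_one] at h1
    have h2 : ‖gradient E x0‖ ≤ L := hΩS hx0
    have h3 : (‖gradient E (x t)‖ * Real.exp (δ * t)) ^ 2 ≤ L ^ 2 := by
      rw [mul_pow, ← Real.exp_nat_mul]
      calc _ = ‖gradient E (x t)‖ ^ 2 * Real.exp (2 * δ * t) := by push_cast; ring_nf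
        _ ≤ _ := h1
        _ ≤ L ^ 2 := by gcongr
    have h4 := (pow_le_pow_iff_left₀ (by positivity) hL.le two_ne_zero).1 h3
    calc ‖gradient E (x t)‖ = ‖gradient E (x t)‖ * Real.exp (δ * t) * Real.exp (-δ * t) := by
          rw [mul_assoc, ← Real.exp_add]; simp
      _ ≤ _ := by gcongr
  have hcau : ∀ a ∈ Ici (0:ℝ), ∀ b, a ≤ b → ‖x b - x a‖ ≤ L / δ * Real.exp (-δ * a) := by
    intro a ha b hab
    have hB : ∀ s, HasDerivAt (fun s => L / δ * (Real.exp (-δ * a) - Real.exp (-δ * s)))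
        (L * Real.exp (-δ * s)) s := by
      intro s
      have := ((((hasDerivAt_id s).const_mul (-δ)).exp).const_sub (Real.exp (-δ * a))).const_mul
        (L / δ)
      refine this.congr_deriv ?_
      simp only [id]
      field_simp
    have := image_norm_le_of_norm_deriv_right_le_deriv_boundary (a := a) (b := b)
      (f := fun s => x s - x a) (f' := fun s => G (x s))
      (hxc.sub continuous_const).continuousOn
      (fun s _ => ((hx s).sub_const (x a)).hasDerivWithinAt) (by simp) hB
      (fun s hs => by
        have hs0 : s ∈ Ici (0:ℝ) := le_trans ha hs.1
        obtain ⟨w, hw, hG, -⟩ := hsol s hs0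
        rw [hG, isdField, norm_neg, reflect_norm hw.1]
        exact hdecay s hs0) (right_mem_Icc.2 hab)
    refine this.trans ?_
    gcongr
    linarith [Real.exp_pos (-δ * b)]
  have hexp0 : Tendsto (fun n : ℕ => Real.exp (-δ * n)) atTop (𝓝 0) := by
    refine Real.tendsto_exp_atBot.comp ?_
    exact tendsto_natCast_atTop_atTop.const_mul_atTop_of_neg (by linarith)
  have hcs : CauchySeq (fun n : ℕ => x n) := by
    refine cauchySeq_of_le_tendsto_0' (fun n : ℕ => L / δ * Real.exp (-δ * n)) ?_ ?_
    · intro n m hnm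
      rw [dist_comm, dist_eq_norm]
      exact hcau n (mem_Ici.2 (Nat.cast_nonneg n)) m (by exact_mod_cast hnm)
    · simpa using hexp0.const_mul (L / δ)
  obtain ⟨xs, hxs⟩ := cauchySeq_tendsto_of_complete hcs
  have hxsΩ : xs ∈ Ω := hclosed.mem_of_tendsto hxs
    (Eventually.of_forall fun n => hmem n (mem_Ici.2 (Nat.cast_nonneg n)))
  have hgc : Continuous (gradient E) := (grad_contDiff hE).continuous
  have hgxs : gradient E xs = 0 := by
    have h1 : Tendsto (fun n : ℕ => ‖gradient E (x n)‖) atTop (𝓝 ‖gradient E xs‖) :=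
      ((hgc.norm.tendsto xs).comp hxs)
    have h2 : ‖gradient E xs‖ ≤ L * 0 := le_of_tendsto_of_tendsto' h1 (hexp0.const_mul L)
      (fun n => hdecay n (mem_Ici.2 (Nat.cast_nonneg n)))
    rw [mul_zero] at h2
    exact norm_le_zero_iff.1 h2
  refine ⟨x, hx00, hmem, ?_, ?_, ?_, xs, hxsΩ, ⟨hgxs, lam1 xs, lam2 xs, heig xs hxsΩ⟩,
    L / δ, δ, by positivity, hδ, ?_⟩
  · have : ContDiff ℝ 1 x := by
      rw [contDiff_one_iff_deriv]
      refine ⟨fun t => (hx t).differentiableAt, ?_⟩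
      have : deriv x = fun t => G (x t) := funext fun t => (hx t).deriv
      rw [this]
      exact hGl.continuous.comp hxc
    exact this.contDiffOn
  · intro t ht
    obtain ⟨w, hw, hG, -⟩ := hsol t ht
    exact ⟨w, hw, hG ▸ hx t⟩
  · intro y hy0 hy T hT
    have hycont : ContinuousOn y (Icc 0 T) := fun t ht => by
      obtain ⟨w, -, hd⟩ := hy t ht.1
      exact hd.continuousAt.continuousWithinAt
    have hcl : IsClosed ({t | y t = x t} ∩ Icc 0 T) := by
      have : {t | y t = x t} ∩ Icc 0 T = Icc 0 T ∩ (fun t => y t - x t) ⁻¹' {0} := by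
        ext t; simp [sub_eq_zero, and_comm]
      rw [this]
      exact (hycont.sub hxc.continuousOn).preimage_isClosed_of_isClosed isClosed_Icc
        isClosed_singleton
    have hsub := hcl.Icc_subset_of_forall_mem_nhdsWithin
      (show (0:ℝ) ∈ {t | y t = x t} by simp [hy0, hx00]) (by
      rintro t ⟨hte, ht⟩
      have hte' : y t = x t := hte
      obtain ⟨w, -, hd⟩ := hy t ht.1
      have hyV : y ⁻¹' V ∈ 𝓝 t := hd.continuousAt.preimage_mem_nhds
        (hV.mem_nhds (by rw [hte']; exact hΩV (hmem t ht.1)))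
      obtain ⟨ε, hε, hball⟩ := Metric.mem_nhds_iff.1 hyV
      have hyd : ∀ s ∈ Ico t (t + ε), HasDerivAt y (G (y s)) s := by
        intro s hs
        obtain ⟨w, hw, hd⟩ := hy s (ht.1.trans hs.1)
        have hsV : y s ∈ V := hball (by
          rw [Metric.mem_ball, Real.dist_eq, abs_of_nonneg (by linarith [hs.1])]
          linarith [hs.2])
        rw [(hGV (y s) hsV w hw).1]
        exact hd
      have heq : EqOn y x (Icc t (t + ε / 2)) :=
        ODE_solution_unique_of_mem_Icc_right (v := fun _ => G) (s := fun _ => univ) (K := K)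
          (fun s _ => hGl.lipschitzOnWith)
          (fun s hs => (hyd s ⟨hs.1, by linarith [hs.2]⟩).continuousAt.continuousWithinAt)
          (fun s hs => (hyd s ⟨hs.1, by linarith [hs.2]⟩).hasDerivWithinAt)
          (fun s _ => mem_univ _)
          hxc.continuousOn
          (fun s _ => (hx s).hasDerivWithinAt)
          (fun s _ => mem_univ _) hte'
      exact mem_of_superset (Ioc_mem_nhdsGT (by linarith : t < t + ε / 2))
        (fun s hs => heq ⟨hs.1.le, hs.2⟩))
    exact hsub ⟨hT, le_rfl⟩
  · intro t ht
    have h1 : Tendsto (fun n : ℕ => ‖x n - x t‖) atTop (𝓝 ‖xs - x t‖) :=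
      (hxs.sub_const (x t)).norm
    rw [norm_sub_rev]
    refine le_of_tendsto h1 ?_
    filter_upwards [eventually_ge_atTop ⌈t⌉₊] with n hn
    exact hcau t ht n (Nat.ceil_le.1 hn)
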